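/- arXiv:2502.01055 — 4 statements merged into one kernel-verified Lean document; each statement's English description precedes it below -/
import Mathlib

section
/- Let J : ℝⁿ → ℝ and c₁, …, c_m : ℝⁿ → ℝ be differentiable at a point x ∈ ℝⁿ, let μ₁, …, μ_m > 0, and let φ₁(y) = J(y) + Σᵢ μᵢ·|cᵢ(y)|. Then for every direction p ∈ ℝⁿ, the one-sided limit as t → 0⁺ of (φ₁(x + t·p) − φ₁(x))/t exists and equals ⟨∇J(x), p⟩ + Σ_{i : cᵢ(x) > 0} μᵢ·⟨∇cᵢ(x), p⟩ − Σ_{i : cᵢ(x) < 0} μᵢ·⟨∇cᵢ(x), p⟩ + Σ_{i : cᵢ(x) = 0} μᵢ·|⟨∇cᵢ(x), p⟩|. -/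
open Topology Filter

/-- The right derivative of `|g|` at a point where `g` has derivative `g'`. -/
theorem HasDerivAt.abs_hasDerivWithinAt_Ioi {g : ℝ → ℝ} {g' a : ℝ} (hg : HasDerivAt g g' a) :
    HasDerivWithinAt (fun t => |g t|)
      (if 0 < g a then g' else if g a < 0 then -g' else |g'|) (Set.Ioi a) a := by
  split_ifs with hpos hneg
  · refine (hg.congr_of_eventuallyEq ?_).hasDerivWithinAt
    filter_upwards [hg.continuousAt.eventually (lt_mem_nhds hpos)] with t ht
    exact abs_of_pos ht
  · refine (hg.neg.congr_of_eventuallyEq ?_).hasDerivWithinAt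
    filter_upwards [hg.continuousAt.eventually (gt_mem_nhds hneg)] with t ht
    exact abs_of_neg ht
  · have hzero : g a = 0 := le_antisymm (not_lt.1 hpos) (not_lt.1 hneg)
    rw [hasDerivWithinAt_iff_tendsto_slope' Set.self_notMem_Ioi]
    refine ((hasDerivWithinAt_iff_tendsto_slope' Set.self_notMem_Ioi).1
      (hg.hasDerivWithinAt (s := Set.Ioi a))).abs.congr' ?_
    filter_upwards [self_mem_nhdsWithin] with t ht
    simp [slope_def_field, hzero, abs_div, abs_of_pos (sub_pos.2 (Set.mem_Ioi.1 ht))]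

/-- Directional derivative of the weighted ℓ₁ merit function with equality-constraint
penalties: if J and the cᵢ are differentiable at x and μᵢ > 0, then for every direction p
the one-sided limit of (φ₁(x + t·p) − φ₁(x))/t as t → 0⁺ exists and equals
⟨∇J(x),p⟩ + Σ_{cᵢ(x)>0} μᵢ⟨∇cᵢ(x),p⟩ − Σ_{cᵢ(x)<0} μᵢ⟨∇cᵢ(x),p⟩ + Σ_{cᵢ(x)=0} μᵢ|⟨∇cᵢ(x),p⟩|. -/
theorem l1_merit_eq_directional_derivative
    (n m : ℕ) (J : (Fin n → ℝ) → ℝ) (c : Fin m → (Fin n → ℝ) → ℝ)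
    (μ : Fin m → ℝ) (hμ : ∀ i, 0 < μ i) (x : Fin n → ℝ)
    (hJ : DifferentiableAt ℝ J x) (hc : ∀ i, DifferentiableAt ℝ (c i) x)
    (φ : (Fin n → ℝ) → ℝ) (hφ : φ = fun y => J y + ∑ i, μ i * |c i y|) :
    ∀ p : Fin n → ℝ,
      Tendsto (fun t : ℝ => (φ (x + t • p) - φ x) / t) (𝓝[>] 0)
        (𝓝 (fderiv ℝ J x p
          + ∑ i ∈ Finset.univ.filter (fun i => 0 < c i x), μ i * fderiv ℝ (c i) x p
          - ∑ i ∈ Finset.univ.filter (fun i => c i x < 0), μ i * fderiv ℝ (c i) x p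
          + ∑ i ∈ Finset.univ.filter (fun i => c i x = 0), μ i * |fderiv ℝ (c i) x p|)) := by
  intro p
  have hline : ∀ f : (Fin n → ℝ) → ℝ, DifferentiableAt ℝ f x →
      HasDerivAt (fun t : ℝ => f (x + t • p)) (fderiv ℝ f x p) 0 :=
    fun f hf => hf.hasFDerivAt.hasLineDerivAt p
  have hsum := (hline J hJ).hasDerivWithinAt (s := Set.Ioi 0) |>.add
    (HasDerivWithinAt.fun_sum (u := Finset.univ) fun i _ =>
      (hline (c i) (hc i)).abs_hasDerivWithinAt_Ioi.const_mul (μ i))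
  have hlim := (hasDerivWithinAt_iff_tendsto_slope' Set.self_notMem_Ioi).1 hsum
  subst hφ
  convert hlim using 1
  · ext t
    simp [slope_def_field]
  · congr 1
    simp only [Finset.sum_filter, zero_smul, add_zero]
    rw [add_sub_assoc, add_assoc, ← Finset.sum_sub_distrib, ← Finset.sum_add_distrib]
    congr 1
    refine Finset.sum_congr rfl fun i _ => ?_
    rcases lt_trichotomy (c i x) 0 with h | h | h
    · simp [h, h.ne, h.not_gt]
    · simp [h]
    · simp [h, h.ne', h.not_gt]
end

section
/- Let J : ℝⁿ → ℝ and c₁, …, c_m : ℝⁿ → ℝ be differentiable at a point x ∈ ℝⁿ, let μ₁, …, μ_m > 0, write [r]⁻ = max(0, −r), and let φ₁(y) = J(y) + Σᵢ μᵢ·[cᵢ(y)]⁻. Then for every direction p ∈ ℝⁿ, the one-sided limit as t → 0⁺ of (φ₁(x + t·p) − φ₁(x))/t exists and equals ⟨∇J(x), p⟩ − Σ_{i : cᵢ(x) < 0} μᵢ·⟨∇cᵢ(x), p⟩ + Σ_{i : cᵢ(x) = 0} μᵢ·[⟨∇cᵢ(x), p⟩]⁻. -/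
open Topology Filter

section OneSidedDerivative

variable {E : Type*} [NormedAddCommGroup E] [NormedSpace ℝ E] {f : E → ℝ} {x : E}

theorem DifferentiableAt.tendsto_div_zero_right (hf : DifferentiableAt ℝ f x) (p : E) :
    Tendsto (fun t : ℝ => (f (x + t • p) - f x) / t) (𝓝[>] 0) (𝓝 (fderiv ℝ f x p)) := by
  simpa [div_eq_inv_mul] using
    (hf.hasFDerivAt.hasLineDerivAt p).tendsto_slope_zero_right

/-- The one-sided directional derivative of the negative part `max 0 (-f)` of a function
differentiable at `x`. -/
theorem DifferentiableAt.tendsto_max_zero_neg_div_zero_right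
    (hf : DifferentiableAt ℝ f x) (p : E) :
    Tendsto (fun t : ℝ => (max 0 (-f (x + t • p)) - max 0 (-f x)) / t) (𝓝[>] 0)
      (𝓝 (-(if f x < 0 then fderiv ℝ f x p else 0)
        + if f x = 0 then max 0 (-fderiv ℝ f x p) else 0)) := by
  have hslope := hf.tendsto_div_zero_right p
  have hcont : Tendsto (fun t : ℝ => f (x + t • p)) (𝓝[>] 0) (𝓝 (f x)) := by
    have hline : Tendsto (fun t : ℝ => x + t • p) (𝓝[>] 0) (𝓝 x) :=
      (Continuous.tendsto' (by fun_prop) 0 x (by simp)).mono_left nhdsWithin_le_nhds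
    exact hf.continuousAt.tendsto.comp hline
  rcases lt_trichotomy (f x) 0 with h | h | h
  · simp only [h, h.ne, if_true, if_false, add_zero]
    refine hslope.neg.congr' ?_
    filter_upwards [hcont.eventually_lt_const h] with t ht
    rw [max_eq_right (by linarith), max_eq_right (by linarith)]
    ring
  · simp only [h, lt_irrefl, if_true, if_false, neg_zero, zero_add, max_self, sub_zero]
      at hslope ⊢
    refine (tendsto_const_nhds.max hslope.neg).congr' ?_
    filter_upwards [self_mem_nhdsWithin] with t ht
    rw [← max_div_div_right (le_of_lt ht), zero_div, neg_div]
  · simp only [h.not_gt, h.ne', if_false, neg_zero, add_zero]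
    refine tendsto_const_nhds.congr' ?_
    filter_upwards [hcont.eventually_const_lt h] with t ht
    rw [max_eq_left (by linarith), max_eq_left (by linarith), sub_zero, zero_div]

end OneSidedDerivative

/-- Directional derivative of the weighted ℓ₁ merit function with inequality-constraint
penalties [r]⁻ = max(0,−r): if J and the cᵢ are differentiable at x and μᵢ > 0, then for
every direction p the one-sided limit of (φ₁(x + t·p) − φ₁(x))/t as t → 0⁺ exists and
equals ⟨∇J(x),p⟩ − Σ_{cᵢ(x)<0} μᵢ⟨∇cᵢ(x),p⟩ + Σ_{cᵢ(x)=0} μᵢ[⟨∇cᵢ(x),p⟩]⁻. -/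
theorem l1_merit_ineq_directional_derivative
    (n m : ℕ) (J : (Fin n → ℝ) → ℝ) (c : Fin m → (Fin n → ℝ) → ℝ)
    (μ : Fin m → ℝ) (hμ : ∀ i, 0 < μ i) (x : Fin n → ℝ)
    (hJ : DifferentiableAt ℝ J x) (hc : ∀ i, DifferentiableAt ℝ (c i) x)
    (negp : ℝ → ℝ) (hnegp : negp = fun r => max 0 (-r))
    (φ : (Fin n → ℝ) → ℝ) (hφ : φ = fun y => J y + ∑ i, μ i * negp (c i y)) :
    ∀ p : Fin n → ℝ,
      Tendsto (fun t : ℝ => (φ (x + t • p) - φ x) / t) (𝓝[>] 0)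
        (𝓝 (fderiv ℝ J x p
          - ∑ i ∈ Finset.univ.filter (fun i => c i x < 0), μ i * fderiv ℝ (c i) x p
          + ∑ i ∈ Finset.univ.filter (fun i => c i x = 0),
              μ i * negp (fderiv ℝ (c i) x p))) := by
  subst hnegp hφ
  intro p
  have hsum := (hJ.tendsto_div_zero_right p).add (tendsto_finsetSum Finset.univ fun i _ =>
    ((hc i).tendsto_max_zero_neg_div_zero_right p).const_mul (μ i))
  convert hsum using 2
  · simp only [← mul_div_assoc, ← Finset.sum_div, mul_sub, Finset.sum_sub_distrib]
    ring
  · simp only [Finset.sum_filter, mul_add, mul_neg, mul_ite, mul_zero,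
      Finset.sum_add_distrib, Finset.sum_neg_distrib]
    ring
end

section
/- Let J : ℝⁿ → ℝ be convex and continuously differentiable, and let c₁, …, c_m : ℝⁿ → ℝ be differentiable with Lipschitz continuous gradients ∇cᵢ. Fix penalty parameters μ₁, …, μ_m > 0 and define the merit function φ₁(x; μ) = J(x) + Σᵢ μᵢ·|cᵢ(x)|. Let (x_k)_{k∈ℕ} be a sequence in ℝⁿ converging to a point x*, and suppose there exist radii Δ_k and a constant Δ_min > 0 with Δ_k ≥ Δ_min for all k, such that for every k the next iterate x_{k+1} minimizes the convex model q_k(y) = J(y) + Σᵢ μᵢ·|cᵢ(x_k) + ⟨∇cᵢ(x_k), y − x_k⟩| over the ℓ∞ ball {y ∈ ℝⁿ | ‖y − x_k‖_∞ ≤ Δ_k}. Then x* is a stationary point of the merit function: for every direction p ∈ ℝⁿ, the one-sided directional derivative D(φ₁(x*; μ); p) = lim_{t→0⁺} (φ₁(x* + t·p; μ) − φ₁(x*; μ))/t exists and is nonnegative. -/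
open Topology Filter

/-- The right derivative of `|f|` at `0` exists and depends only on the value and the derivative
of `f` at `0`. -/
theorem exists_tendsto_slope_abs (a b : ℝ) :
    ∃ L : ℝ, ∀ f : ℝ → ℝ, f 0 = a → HasDerivAt f b 0 →
      Tendsto (fun t : ℝ => (|f t| - |f 0|) / t) (𝓝[>] 0) (𝓝 L) := by
  by_cases ha : a = 0
  · refine ⟨|b|, fun f hf hd => ?_⟩
    have h := (hd.tendsto_slope_zero_right).abs
    refine h.congr' ?_
    filter_upwards [self_mem_nhdsWithin] with t ht
    have ht : 0 < t := ht
    simp [hf, ha, abs_mul, abs_of_pos ht, div_eq_inv_mul]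
  · refine ⟨SignType.sign a * b, fun f hf hd => ?_⟩
    have hd' : HasDerivAt (fun t => |f t|) (SignType.sign a * b) 0 := by
      have h := (hasDerivAt_abs (hf ▸ ha : f 0 ≠ 0)).comp 0 hd
      rwa [hf] at h
    refine hd'.tendsto_slope_zero_right.congr fun t => ?_
    simp [div_eq_inv_mul]

/-- Theorem 3 (Convergence), equality-constrained case: let J be convex and
continuously differentiable, and each cᵢ be differentiable with Lipschitz gradient.
If the CRISP iterates x_k — where x_{k+1} minimizes the convex model
q_k(y) = J(y) + Σᵢ μᵢ|cᵢ(x_k) + ⟨∇cᵢ(x_k), y − x_k⟩| over the ℓ∞ ball of radius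
Δ_k ≥ Δ_min > 0 around x_k — converge to x*, then x* is a stationary point of the merit
function φ₁(x;μ) = J(x) + Σᵢ μᵢ|cᵢ(x)|: every one-sided directional derivative of φ₁ at
x* exists and is nonnegative. (On `Fin n → ℝ`, `‖·‖` is the sup (ℓ∞) norm.) -/
theorem crisp_convergence_eq_constraints
    (n m : ℕ) (J : (Fin n → ℝ) → ℝ)
    (hJconv : ConvexOn ℝ Set.univ J) (hJsmooth : ContDiff ℝ 1 J)
    (c : Fin m → (Fin n → ℝ) → ℝ)
    (hcdiff : ∀ i, Differentiable ℝ (c i))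
    (hclip : ∀ i, ∃ K : NNReal, LipschitzWith K (fun y => fderiv ℝ (c i) y))
    (μ : Fin m → ℝ) (hμ : ∀ i, 0 < μ i)
    (φ : (Fin n → ℝ) → ℝ) (hφ : φ = fun y => J y + ∑ i, μ i * |c i y|)
    (q : ℕ → (Fin n → ℝ) → ℝ)
    (x : ℕ → Fin n → ℝ) (xs : Fin n → ℝ)
    (hq : ∀ k, q k = fun y =>
      J y + ∑ i, μ i * |c i (x k) + fderiv ℝ (c i) (x k) (y - x k)|)
    (hconv : Tendsto x atTop (𝓝 xs))
    (Δ : ℕ → ℝ) (Δmin : ℝ) (hΔmin : 0 < Δmin) (hΔ : ∀ k, Δmin ≤ Δ k)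
    (hstep : ∀ k, x (k + 1) ∈ {y : Fin n → ℝ | ‖y - x k‖ ≤ Δ k} ∧
      IsMinOn (q k) {y : Fin n → ℝ | ‖y - x k‖ ≤ Δ k} (x (k + 1))) :
    ∀ p : Fin n → ℝ, ∃ D : ℝ,
      Tendsto (fun t : ℝ => (φ (xs + t • p) - φ xs) / t) (𝓝[>] 0) (𝓝 D) ∧ 0 ≤ D := by
  intro p
  have hC : ∀ i, Continuous (fun y => fderiv ℝ (c i) y) := fun i =>
    (hclip i).choose_spec.continuous
  -- The model at the limit point is minimized there over the ball of radius `Δmin`.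
  have hmin : ∀ d : Fin n → ℝ, ‖d‖ ≤ Δmin →
      φ xs ≤ J (xs + d) + ∑ i, μ i * |c i xs + fderiv ℝ (c i) xs d| := by
    intro d hd
    have hk : ∀ k, J (x (k + 1)) +
        ∑ i, μ i * |c i (x k) + fderiv ℝ (c i) (x k) (x (k + 1) - x k)| ≤
        J (x k + d) + ∑ i, μ i * |c i (x k) + fderiv ℝ (c i) (x k) d| := by
      intro k
      have hmem : x k + d ∈ {y : Fin n → ℝ | ‖y - x k‖ ≤ Δ k} := by
        simpa using hd.trans (hΔ k)
      have h := (hstep k).2 hmem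
      simpa [hq k] using h
    have hconv' : Tendsto (fun k => x (k + 1)) atTop (𝓝 xs) :=
      hconv.comp (tendsto_add_atTop_nat 1)
    have hJc := hJsmooth.continuous
    have happ : ∀ i (u : ℕ → Fin n → ℝ) (v : Fin n → ℝ), Tendsto u atTop (𝓝 v) →
        Tendsto (fun k => fderiv ℝ (c i) (x k) (u k)) atTop (𝓝 (fderiv ℝ (c i) xs v)) :=
      fun i u v hu => (isBoundedBilinearMap_apply.continuous.tendsto (fderiv ℝ (c i) xs, v)).comp
        ((((hC i).tendsto xs).comp hconv).prodMk_nhds hu)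
    have hl : Tendsto (fun k => J (x (k + 1)) +
        ∑ i, μ i * |c i (x k) + fderiv ℝ (c i) (x k) (x (k + 1) - x k)|) atTop (𝓝 (φ xs)) := by
      have h := ((hJc.tendsto xs).comp hconv').add (tendsto_finsetSum Finset.univ fun i _ =>
        ((((hcdiff i).continuous.tendsto xs).comp hconv).add
          (happ i _ _ (hconv'.sub hconv))).abs.const_mul (μ i))
      simpa [hφ] using h
    have hr : Tendsto (fun k => J (x k + d) +
        ∑ i, μ i * |c i (x k) + fderiv ℝ (c i) (x k) d|) atTop
        (𝓝 (J (xs + d) + ∑ i, μ i * |c i xs + fderiv ℝ (c i) xs d|)) := by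
      exact ((hJc.tendsto (xs + d)).comp (hconv.add_const d)).add
        (tendsto_finsetSum Finset.univ fun i _ =>
          ((((hcdiff i).continuous.tendsto xs).comp hconv).add
            (happ i _ _ tendsto_const_nhds)).abs.const_mul (μ i))
    exact le_of_tendsto_of_tendsto' hl hr hk
  choose L hL using fun i => exists_tendsto_slope_abs (c i xs) (fderiv ℝ (c i) xs p)
  have hline : HasDerivAt (fun t : ℝ => xs + t • p) p 0 := by
    simpa using ((hasDerivAt_id (0 : ℝ)).smul_const p).const_add xs
  have hcomp : ∀ f : (Fin n → ℝ) → ℝ, Differentiable ℝ f →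
      HasDerivAt (fun t : ℝ => f (xs + t • p)) (fderiv ℝ f xs p) 0 := fun f hf =>
    (hf xs).hasFDerivAt.comp_hasDerivAt_of_eq 0 hline (by simp)
  have hJt : Tendsto (fun t : ℝ => (J (xs + t • p) - J xs) / t) (𝓝[>] 0)
      (𝓝 (fderiv ℝ J xs p)) := by
    refine (hcomp J (hJsmooth.differentiable one_ne_zero)).tendsto_slope_zero_right.congr
      fun t => ?_
    simp [div_eq_inv_mul]
  have hlim : ∀ g : Fin m → ℝ → ℝ, (∀ i, g i 0 = c i xs) →
      (∀ i, HasDerivAt (g i) (fderiv ℝ (c i) xs p) 0) →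
      Tendsto (fun t : ℝ => (J (xs + t • p) + ∑ i, μ i * |g i t| - φ xs) / t) (𝓝[>] 0)
        (𝓝 (fderiv ℝ J xs p + ∑ i, μ i * L i)) := by
    intro g hg0 hg
    refine (hJt.add (tendsto_finsetSum Finset.univ fun i _ =>
      (hL i (g i) (hg0 i) (hg i)).const_mul (μ i))).congr fun t => ?_
    simp only [hφ, hg0, ← mul_div_assoc, ← Finset.sum_div, mul_sub, Finset.sum_sub_distrib]
    ring
  refine ⟨fderiv ℝ J xs p + ∑ i, μ i * L i, ?_, ?_⟩
  · refine (hlim (fun i t => c i (xs + t • p)) (by simp) fun i => hcomp _ (hcdiff i)).congr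
      fun t => ?_
    simp [hφ]
  · refine ge_of_tendsto (hlim (fun i t => c i xs + fderiv ℝ (c i) xs (t • p)) (by simp)
      fun i => ?_) ?_
    · simpa using ((hasDerivAt_id (0 : ℝ)).mul_const (fderiv ℝ (c i) xs p)).const_add (c i xs)
    · have hsmall : ∀ᶠ t : ℝ in 𝓝[>] 0, ‖t • p‖ < Δmin := by
        have h : Tendsto (fun t : ℝ => ‖t • p‖) (𝓝 0) (𝓝 0) := by
          have h' : Continuous fun t : ℝ => ‖t • p‖ := by fun_prop
          simpa using h'.tendsto 0
        exact (h.mono_left nhdsWithin_le_nhds).eventually_lt_const hΔmin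
      filter_upwards [hsmall, self_mem_nhdsWithin] with t ht ht0
      exact div_nonneg (sub_nonneg.2 (hmin _ ht.le)) (le_of_lt ht0)
end

section
/- Let J : ℝⁿ → ℝ be convex and continuously differentiable, let c_i : ℝⁿ → ℝ for i in a finite index set ℰ ∪ ℐ (with ℰ, ℐ disjoint) be differentiable with Lipschitz continuous gradients ∇cᵢ, fix μᵢ > 0, write [r]⁻ = max(0, −r), and define the merit function φ₁(x; μ) = J(x) + Σ_{i∈ℰ} μᵢ·|cᵢ(x)| + Σ_{i∈ℐ} μᵢ·[cᵢ(x)]⁻. Let (x_k)_{k∈ℕ} be a sequence in ℝⁿ converging to a point x*, and suppose there exist radii Δ_k and a constant Δ_min > 0 with Δ_k ≥ Δ_min for all k, such that for every k the next iterate x_{k+1} minimizes the convex model q_k(y) = J(y) + Σ_{i∈ℰ} μᵢ·|cᵢ(x_k) + ⟨∇cᵢ(x_k), y − x_k⟩| + Σ_{i∈ℐ} μᵢ·[cᵢ(x_k) + ⟨∇cᵢ(x_k), y − x_k⟩]⁻ over the ℓ∞ ball {y ∈ ℝⁿ | ‖y − x_k‖_∞ ≤ Δ_k}. Then x* is a stationary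 point of the merit function: for every direction p ∈ ℝⁿ, the one-sided directional derivative D(φ₁(x*; μ); p) = lim_{t→0⁺} (φ₁(x* + t·p; μ) − φ₁(x*; μ))/t exists and is nonnegative. -/
open Topology Filter

/-- The positive part of a function differentiable at `0` has a right derivative there which
depends only on the value and the derivative of the function at `0`. -/
lemma exists_hasDerivWithinAt_max_zero (a d : ℝ) :
    ∃ D : ℝ, ∀ f : ℝ → ℝ, f 0 = a → HasDerivAt f d 0 →
      HasDerivWithinAt (fun t => max 0 (f t)) D (Set.Ioi 0) 0 := by
  rcases lt_trichotomy a 0 with ha | rfl | ha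
  · refine ⟨0, fun f hf hd => ?_⟩
    have h : (fun t => max 0 (f t)) =ᶠ[𝓝 0] fun _ => 0 := by
      filter_upwards [hd.continuousAt.eventually (gt_mem_nhds (hf.trans_lt ha))] with t ht
      exact max_eq_left ht.le
    exact ((hasDerivAt_const (0 : ℝ) (0 : ℝ)).congr_of_eventuallyEq h).hasDerivWithinAt
  · refine ⟨max 0 d, fun f hf hd => ?_⟩
    rw [hasDerivWithinAt_iff_tendsto_slope' (by simp)]
    have h := (hasDerivWithinAt_iff_tendsto_slope' (by simp)).1 (hd.hasDerivWithinAt (s := Set.Ioi 0))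
    refine (tendsto_const_nhds.max h).congr' ?_
    filter_upwards [self_mem_nhdsWithin] with t ht
    have ht : 0 < t := ht
    simp only [slope_def_field, hf, sub_zero, max_self]
    rw [← max_div_div_right ht.le, zero_div]
  · refine ⟨d, fun f hf hd => ?_⟩
    have h : (fun t => max 0 (f t)) =ᶠ[𝓝 0] f := by
      filter_upwards [hd.continuousAt.eventually (lt_mem_nhds (ha.trans_eq hf.symm))] with t ht
      exact max_eq_right ht.le
    exact (hd.congr_of_eventuallyEq h).hasDerivWithinAt

/-- The absolute value of a function differentiable at `0` has a right derivative there which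
depends only on the value and the derivative of the function at `0`. -/
lemma exists_hasDerivWithinAt_abs (a d : ℝ) :
    ∃ D : ℝ, ∀ f : ℝ → ℝ, f 0 = a → HasDerivAt f d 0 →
      HasDerivWithinAt (fun t => |f t|) D (Set.Ioi 0) 0 := by
  obtain ⟨D₁, h₁⟩ := exists_hasDerivWithinAt_max_zero a d
  obtain ⟨D₂, h₂⟩ := exists_hasDerivWithinAt_max_zero (-a) (-d)
  refine ⟨D₁ + D₂, fun f hf hd => ?_⟩
  have h := (h₁ f hf hd).add (h₂ (fun t => -f t) (by simp [hf]) hd.neg)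
  have e : (fun t => |f t|) = (fun t => max 0 (f t)) + fun t => max 0 (-f t) := by
    ext t
    rcases le_total 0 (f t) with ht | ht
    · simp [abs_of_nonneg ht, ht]
    · simp [abs_of_nonpos ht, ht]
  rw [e]
  exact h

/-- Theorem 3 (Convergence), general case with equality constraints (i ∈ ℰ) and
inequality constraints (i ∈ ℐ): let J be convex and continuously differentiable, each
cᵢ differentiable with Lipschitz gradient, μᵢ > 0, and [r]⁻ = max(0,−r). If the CRISP
iterates x_k — where x_{k+1} minimizes the convex model
q_k(y) = J(y) + Σ_{i∈ℰ} μᵢ|cᵢ(x_k) + ⟨∇cᵢ(x_k), y−x_k⟩|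
       + Σ_{i∈ℐ} μᵢ[cᵢ(x_k) + ⟨∇cᵢ(x_k), y−x_k⟩]⁻
over the ℓ∞ ball of radius Δ_k ≥ Δ_min > 0 around x_k — converge to x*, then x* is a
stationary point of the merit function φ₁(x;μ) = J(x) + Σ_{i∈ℰ} μᵢ|cᵢ(x)| +
Σ_{i∈ℐ} μᵢ[cᵢ(x)]⁻: every one-sided directional derivative of φ₁ at x* exists and is
nonnegative. (On `Fin n → ℝ`, `‖·‖` is the sup (ℓ∞) norm.) -/
theorem crisp_convergence_general
    (n : ℕ) {ι : Type*} [Fintype ι] [DecidableEq ι]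
    (J : (Fin n → ℝ) → ℝ)
    (hJconv : ConvexOn ℝ Set.univ J) (hJsmooth : ContDiff ℝ 1 J)
    (c : ι → (Fin n → ℝ) → ℝ)
    (E I : Finset ι) (hEI : Disjoint E I)
    (hcdiff : ∀ i ∈ E ∪ I, Differentiable ℝ (c i))
    (hclip : ∀ i ∈ E ∪ I, ∃ K : NNReal, LipschitzWith K (fun y => fderiv ℝ (c i) y))
    (μ : ι → ℝ) (hμ : ∀ i ∈ E ∪ I, 0 < μ i)
    (negp : ℝ → ℝ) (hnegp : negp = fun r => max 0 (-r))
    (φ : (Fin n → ℝ) → ℝ)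
    (hφ : φ = fun y => J y + ∑ i ∈ E, μ i * |c i y| + ∑ i ∈ I, μ i * negp (c i y))
    (q : ℕ → (Fin n → ℝ) → ℝ)
    (x : ℕ → Fin n → ℝ) (xs : Fin n → ℝ)
    (hq : ∀ k, q k = fun y =>
      J y + ∑ i ∈ E, μ i * |c i (x k) + fderiv ℝ (c i) (x k) (y - x k)|
        + ∑ i ∈ I, μ i * negp (c i (x k) + fderiv ℝ (c i) (x k) (y - x k)))
    (hconv : Tendsto x atTop (𝓝 xs))
    (Δ : ℕ → ℝ) (Δmin : ℝ) (hΔmin : 0 < Δmin) (hΔ : ∀ k, Δmin ≤ Δ k)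
    (hstep : ∀ k, x (k + 1) ∈ {y : Fin n → ℝ | ‖y - x k‖ ≤ Δ k} ∧
      IsMinOn (q k) {y : Fin n → ℝ | ‖y - x k‖ ≤ Δ k} (x (k + 1))) :
    ∀ p : Fin n → ℝ, ∃ D : ℝ,
      Tendsto (fun t : ℝ => (φ (xs + t • p) - φ xs) / t) (𝓝[>] 0) (𝓝 D) ∧ 0 ≤ D := by
  intro p
  subst hnegp
  have hfc : ∀ i ∈ E ∪ I, Continuous (fderiv ℝ (c i)) := fun i hi =>
    (hclip i hi).choose_spec.continuous
  have hc : ∀ i ∈ E ∪ I, Continuous (c i) := fun i hi => (hcdiff i hi).continuous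
  have hline : HasDerivAt (fun t : ℝ => xs + t • p) p 0 := by
    simpa using ((hasDerivAt_id (0 : ℝ)).smul_const p).const_add xs
  have hcd : ∀ i ∈ E ∪ I,
      HasDerivAt (fun t : ℝ => c i (xs + t • p)) (fderiv ℝ (c i) xs p) 0 := fun i hi =>
    HasFDerivAt.comp_hasDerivAt (0 : ℝ) (by simpa using (hcdiff i hi xs).hasFDerivAt) hline
  have hld : ∀ i, HasDerivAt (fun t : ℝ => c i xs + fderiv ℝ (c i) xs (t • p))
      (fderiv ℝ (c i) xs p) 0 := fun i => by
    simpa using ((hasDerivAt_id (0 : ℝ)).mul_const (fderiv ℝ (c i) xs p)).const_add (c i xs)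
  have hJd : HasDerivAt (fun t : ℝ => J (xs + t • p)) (fderiv ℝ J xs p) 0 :=
    HasFDerivAt.comp_hasDerivAt (0 : ℝ)
      (by simpa using (hJsmooth.differentiable (by simp) xs).hasFDerivAt) hline
  choose DE hDE using fun i => exists_hasDerivWithinAt_abs (c i xs) (fderiv ℝ (c i) xs p)
  choose DI hDI using fun i => exists_hasDerivWithinAt_max_zero (-c i xs) (-fderiv ℝ (c i) xs p)
  set D : ℝ := fderiv ℝ J xs p + ∑ i ∈ E, μ i * DE i + ∑ i ∈ I, μ i * DI i with hD
  have key : ∀ f : ι → ℝ → ℝ, (∀ i, f i 0 = c i xs) →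
      (∀ i ∈ E ∪ I, HasDerivAt (f i) (fderiv ℝ (c i) xs p) 0) →
      HasDerivWithinAt (fun t => J (xs + t • p) + ∑ i ∈ E, μ i * |f i t|
        + ∑ i ∈ I, μ i * max 0 (-f i t)) D (Set.Ioi 0) 0 := fun f hf hd =>
    (hJd.hasDerivWithinAt.add (.fun_sum fun i hi =>
      (hDE i (f i) (hf i) (hd i (Finset.mem_union_left _ hi))).const_mul (μ i))).add
      (.fun_sum fun i hi => (hDI i (fun t => -f i t) (by simp [hf])
        (hd i (Finset.mem_union_right _ hi)).neg).const_mul (μ i))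
  have hφd := key (fun i t => c i (xs + t • p)) (by simp) hcd
  have hmd := key (fun i t => c i xs + fderiv ℝ (c i) xs (t • p)) (by simp) fun i _ => hld i
  rw [hasDerivWithinAt_iff_tendsto_slope' (by simp)] at hφd hmd
  refine ⟨D, hφd.congr fun t => by simp [slope_def_field, hφ], ?_⟩
  have hlim : ∀ (y : ℕ → Fin n → ℝ) (z : Fin n → ℝ), Tendsto y atTop (𝓝 z) →
      Tendsto (fun k => q k (y k)) atTop (𝓝 (J z
        + ∑ i ∈ E, μ i * |c i xs + fderiv ℝ (c i) xs (z - xs)|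
        + ∑ i ∈ I, μ i * max 0 (-(c i xs + fderiv ℝ (c i) xs (z - xs))))) := by
    intro y z hy
    have hl : ∀ i ∈ E ∪ I, Tendsto (fun k => c i (x k) + fderiv ℝ (c i) (x k) (y k - x k)) atTop
        (𝓝 (c i xs + fderiv ℝ (c i) xs (z - xs))) := fun i hi =>
      have hm : Continuous fun w : (Fin n → ℝ) × (Fin n → ℝ) =>
          c i w.1 + fderiv ℝ (c i) w.1 (w.2 - w.1) :=
        ((hc i hi).comp continuous_fst).add
          (((hfc i hi).comp continuous_fst).clm_apply (continuous_snd.sub continuous_fst))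
      (hm.tendsto (xs, z)).comp (hconv.prodMk_nhds hy)
    simp only [hq]
    exact (((hJsmooth.continuous.tendsto z).comp hy).add (tendsto_finsetSum _ fun i hi =>
      (hl i (Finset.mem_union_left _ hi)).abs.const_mul (μ i))).add
      (tendsto_finsetSum _ fun i hi => ((tendsto_const_nhds (x := (0 : ℝ))).max
        (hl i (Finset.mem_union_right _ hi)).neg).const_mul (μ i))
  refine ge_of_tendsto hmd ?_
  have hsmall : ∀ᶠ t : ℝ in 𝓝[>] 0, ‖xs + t • p - xs‖ < Δmin := by
    have hcont : Continuous fun t : ℝ => ‖xs + t • p - xs‖ := by fun_prop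
    exact nhdsWithin_le_nhds (hcont.continuousAt.eventually (gt_mem_nhds (by simpa using hΔmin)))
  filter_upwards [self_mem_nhdsWithin, hsmall] with t ht hts
  have hle := le_of_tendsto_of_tendsto (hlim (fun k => x (k + 1)) xs
    (hconv.comp (tendsto_add_atTop_nat 1))) (hlim (fun _ => xs + t • p) _ tendsto_const_nhds) (by
      have hn : Tendsto (fun k => ‖xs + t • p - x k‖) atTop (𝓝 ‖xs + t • p - xs‖) :=
        (tendsto_const_nhds.sub hconv).norm
      filter_upwards [hn.eventually (gt_mem_nhds hts)] with k hk
      exact (hstep k).2 (hk.le.trans (hΔ k)))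
  rw [slope_def_field]
  refine div_nonneg (sub_nonneg.2 ?_) (sub_nonneg.2 (le_of_lt ht))
  simpa using hle
end
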